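/- arXiv:1406.2098 — 18 statements merged into one kernel-verified Lean document; each statement's English description precedes it below -/
import Mathlib

section
/- (Proposition 5) Let A be a 0/1 adjacency matrix and A_1,…,A_B an ensemble of 0/1 matrices. Then scoreSHD(A) = Σ_{(i,j) : A i j = 1} (1 − 2·p(i,j)) + Σ_{i,j} p(i,j), where the second sum ranges over all ordered pairs (i,j) of nodes. -/
/-- Selection frequency of the ordered pair `(i, j)` in the ensemble `E`. -/
noncomputable def selFreq {p B : ℕ} (E : Fin B → Fin p → Fin p → ℝ) (i j : Fin p) : ℝ :=
  (1 / (B : ℝ)) * ∑ b, E b i j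

/-- SHD aggregation score of the matrix `A` with respect to the ensemble `E`. -/
noncomputable def scoreSHD {p B : ℕ} (E : Fin B → Fin p → Fin p → ℝ)
    (A : Fin p → Fin p → ℝ) : ℝ :=
  (1 / (B : ℝ)) * ∑ b, ∑ i, ∑ j, |A i j - E b i j|

/-- Proposition 5: the SHD aggregation score in terms of edge selection frequencies. -/
theorem scoreSHD_eq_selFreq {p B : ℕ} (hp : 1 ≤ p) (hB : 1 ≤ B)
    (A : Fin p → Fin p → ℝ) (hA01 : ∀ i j, A i j = 0 ∨ A i j = 1)
    (E : Fin B → Fin p → Fin p → ℝ) (hE01 : ∀ b i j, E b i j = 0 ∨ E b i j = 1) :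
    scoreSHD E A =
      (∑ ij ∈ Finset.univ.filter (fun ij : Fin p × Fin p => A ij.1 ij.2 = 1),
        (1 - 2 * selFreq E ij.1 ij.2)) +
      ∑ i, ∑ j, selFreq E i j := by
  have hB0 : (B : ℝ) ≠ 0 := by
    have : B ≠ 0 := by omega
    exact_mod_cast this
  have key : ∀ b i j, |A i j - E b i j| = A i j + (1 - 2 * A i j) * E b i j := by
    intro b i j
    rcases hA01 i j with h | h <;> rcases hE01 b i j with h' | h' <;> rw [h, h'] <;> norm_num
  have hs : scoreSHD E A = ∑ i, ∑ j, (1 / (B : ℝ)) * ∑ b, |A i j - E b i j| := by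
    unfold scoreSHD
    rw [Finset.sum_comm, Finset.mul_sum]
    refine Finset.sum_congr rfl fun i _ => ?_
    rw [Finset.sum_comm, Finset.mul_sum]
  rw [hs, Finset.sum_filter, Fintype.sum_prod_type, ← Finset.sum_add_distrib]
  refine Finset.sum_congr rfl fun i _ => ?_
  rw [← Finset.sum_add_distrib]
  refine Finset.sum_congr rfl fun j _ => ?_
  simp only [key]
  rw [Finset.sum_add_distrib, ← Finset.mul_sum]
  unfold selFreq
  rcases hA01 i j with h | h
  · simp [h]
  · simp only [h, Finset.sum_const, Finset.card_univ, Fintype.card_fin, nsmul_eq_mul, if_true]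
    field_simp
    ring
end

section
/- (Proposition 6, edge addition) Let A be a 0/1 adjacency matrix with A i j = 0 for some pair (i,j), let A_1,…,A_B be an ensemble of 0/1 matrices, and let A' agree with A everywhere except A' i j = 1. Then scoreSHD(A') − scoreSHD(A) = 1 − 2·p(i,j). In particular, if p(i,j) ≤ 1/2 then scoreSHD(A') ≥ scoreSHD(A). -/
/-- Proposition 6, edge addition: adding the edge `(i, j)` changes the SHD aggregation
score by `1 - 2 * p(i,j)`; in particular if `p(i,j) ≤ 1/2` the score does not decrease. -/
theorem scoreSHD_add_edge {p B : ℕ} (hp : 1 ≤ p) (hB : 1 ≤ B)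
    (A A' : Fin p → Fin p → ℝ) (hA01 : ∀ i j, A i j = 0 ∨ A i j = 1)
    (E : Fin B → Fin p → Fin p → ℝ) (hE01 : ∀ b i j, E b i j = 0 ∨ E b i j = 1)
    (i j : Fin p) (hij : A i j = 0)
    (hA'ij : A' i j = 1) (hA' : ∀ k l, (k, l) ≠ (i, j) → A' k l = A k l) :
    scoreSHD E A' - scoreSHD E A = 1 - 2 * selFreq E i j ∧
      (selFreq E i j ≤ 1 / 2 → scoreSHD E A ≤ scoreSHD E A') := by
  have hB0 : (B : ℝ) ≠ 0 := by
    have : B ≠ 0 := by omega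
    exact_mod_cast this
  have key : ∀ b, (∑ k, ∑ l, |A' k l - E b k l|) - (∑ k, ∑ l, |A k l - E b k l|)
      = 1 - 2 * E b i j := by
    intro b
    rw [← Finset.sum_sub_distrib, Finset.sum_eq_single i]
    · rw [← Finset.sum_sub_distrib, Finset.sum_eq_single j]
      · rw [hij, hA'ij]
        rcases hE01 b i j with h | h <;> rw [h] <;> norm_num
      · intro l _ hl
        rw [hA' i l (by simp [hl]), sub_self]
      · simp
    · intro k _ hk
      rw [← Finset.sum_sub_distrib]
      apply Finset.sum_eq_zero
      intro l _
      rw [hA' k l (by simp [hk]), sub_self]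
    · simp
  have main : scoreSHD E A' - scoreSHD E A = 1 - 2 * selFreq E i j := by
    unfold scoreSHD selFreq
    rw [← mul_sub, ← Finset.sum_sub_distrib, Finset.sum_congr rfl (fun b _ => key b),
      Finset.sum_sub_distrib, ← Finset.mul_sum]
    simp only [Finset.sum_const, Finset.card_univ, Fintype.card_fin, nsmul_eq_mul]
    field_simp
  exact ⟨main, fun h => by linarith⟩
end

section
/- (Proposition 6, edge deletion) Let A be a 0/1 adjacency matrix with A i j = 1 for some pair (i,j), let A_1,…,A_B be an ensemble of 0/1 matrices, and let A' agree with A everywhere except A' i j = 0. Then scoreSHD(A') − scoreSHD(A) = 2·p(i,j) − 1. In particular, if p(i,j) > 1/2 then scoreSHD(A') > scoreSHD(A). -/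
/-- Proposition 6, edge deletion: deleting the edge `(i, j)` changes the SHD aggregation
score by `2 * p(i,j) - 1`; in particular if `p(i,j) > 1/2` the score strictly increases. -/
theorem scoreSHD_delete_edge {p B : ℕ} (hp : 1 ≤ p) (hB : 1 ≤ B)
    (A A' : Fin p → Fin p → ℝ) (hA01 : ∀ i j, A i j = 0 ∨ A i j = 1)
    (E : Fin B → Fin p → Fin p → ℝ) (hE01 : ∀ b i j, E b i j = 0 ∨ E b i j = 1)
    (i j : Fin p) (hij : A i j = 1)
    (hA'ij : A' i j = 0) (hA' : ∀ k l, (k, l) ≠ (i, j) → A' k l = A k l) :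
    scoreSHD E A' - scoreSHD E A = 2 * selFreq E i j - 1 ∧
      (1 / 2 < selFreq E i j → scoreSHD E A < scoreSHD E A') := by
  have key : ∀ b, ∑ k, ∑ l, |A' k l - E b k l| - ∑ k, ∑ l, |A k l - E b k l|
      = 2 * E b i j - 1 := by
    intro b
    rw [← Finset.sum_sub_distrib]
    simp_rw [← Finset.sum_sub_distrib]
    rw [Finset.sum_eq_single i, Finset.sum_eq_single j]
    · rw [hij, hA'ij]
      rcases hE01 b i j with h | h <;> rw [h] <;> norm_num
    · intro l _ hl
      rw [hA' i l (by simp [hl]), sub_self]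
    · simp
    · intro k _ hk
      apply Finset.sum_eq_zero
      intro l _
      rw [hA' k l (by simp [hk]), sub_self]
    · simp
  have hB0 : (B : ℝ) ≠ 0 := by
    have : B ≠ 0 := by omega
    exact_mod_cast this
  have main : scoreSHD E A' - scoreSHD E A = 2 * selFreq E i j - 1 := by
    unfold scoreSHD selFreq
    rw [← mul_sub, ← Finset.sum_sub_distrib, Finset.sum_congr rfl (fun b _ => key b),
      Finset.sum_sub_distrib, ← Finset.mul_sum]
    simp only [Finset.sum_const, Finset.card_univ, Fintype.card_fin, nsmul_eq_mul, mul_one]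
    field_simp
  exact ⟨main, fun h => by linarith⟩
end

section
/- (Proposition 6, edge reversal) Let A be a 0/1 adjacency matrix with A i j = 1 and A j i = 0 for some pair of distinct nodes (i,j), let A_1,…,A_B be an ensemble of 0/1 matrices, and let A' agree with A everywhere except A' i j = 0 and A' j i = 1. Then scoreSHD(A') − scoreSHD(A) = 2·(p(i,j) − p(j,i)). If moreover p(i,j) > 1/2 and every ensemble matrix satisfies A_b i j + A_b j i ≤ 1, then scoreSHD(A') > scoreSHD(A). -/
/-- Proposition 6, edge reversal: reversing the edge `(i, j)` changes the SHD aggregation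
score by `2 * (p(i,j) - p(j,i))`; if moreover `p(i,j) > 1/2` and every ensemble matrix
has no 2-cycle on `{i, j}`, then the score strictly increases. -/
theorem scoreSHD_reverse_edge {p B : ℕ} (hp : 1 ≤ p) (hB : 1 ≤ B)
    (A A' : Fin p → Fin p → ℝ) (hA01 : ∀ i j, A i j = 0 ∨ A i j = 1)
    (E : Fin B → Fin p → Fin p → ℝ) (hE01 : ∀ b i j, E b i j = 0 ∨ E b i j = 1)
    (i j : Fin p) (hne : i ≠ j) (hij : A i j = 1) (hji : A j i = 0)
    (hA'ij : A' i j = 0) (hA'ji : A' j i = 1)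
    (hA' : ∀ k l, (k, l) ≠ (i, j) → (k, l) ≠ (j, i) → A' k l = A k l) :
    scoreSHD E A' - scoreSHD E A = 2 * (selFreq E i j - selFreq E j i) ∧
      ((1 / 2 < selFreq E i j ∧ ∀ b, E b i j + E b j i ≤ 1) →
        scoreSHD E A < scoreSHD E A') := by
  have key : ∀ b, (∑ k, ∑ l, |A' k l - E b k l|) - (∑ k, ∑ l, |A k l - E b k l|)
      = 2 * (E b i j - E b j i) := by
    intro b
    rw [← Fintype.sum_prod_type' (fun k l => |A' k l - E b k l|),
      ← Fintype.sum_prod_type' (fun k l => |A k l - E b k l|), ← Finset.sum_sub_distrib]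
    rw [Fintype.sum_eq_add (i, j) (j, i)]
    · simp only [hij, hji, hA'ij, hA'ji]
      rcases hE01 b i j with h1 | h1 <;> rcases hE01 b j i with h2 | h2 <;>
        rw [h1, h2] <;> norm_num
    · intro h
      exact hne (Prod.ext_iff.mp h).1
    · rintro ⟨k, l⟩ ⟨h1, h2⟩
      simp only [hA' k l h1 h2, sub_self]
  have h1 : scoreSHD E A' - scoreSHD E A = 2 * (selFreq E i j - selFreq E j i) := by
    unfold scoreSHD selFreq
    rw [← mul_sub, ← mul_sub, ← Finset.sum_sub_distrib, ← Finset.sum_sub_distrib,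
      Finset.sum_congr rfl (fun b _ => key b), ← Finset.mul_sum]
    ring
  refine ⟨h1, ?_⟩
  rintro ⟨hf, hc⟩
  have hB0 : (0 : ℝ) < B := by exact_mod_cast hB
  have h2 : selFreq E i j + selFreq E j i ≤ 1 := by
    unfold selFreq
    rw [← mul_add, ← Finset.sum_add_distrib, one_div, inv_mul_le_iff₀ hB0]
    calc ∑ b, (E b i j + E b j i) ≤ ∑ _b : Fin B, (1 : ℝ) := Finset.sum_le_sum (fun b _ => hc b)
      _ = B * 1 := by simp
  linarith
end

section
/- (Lemma from the proof of Proposition 7: dropping low-frequency edges) Let A_1,…,A_B be an ensemble of 0/1 matrices and let A be any acyclic 0/1 matrix. Define A⁻ by A⁻ i j = A i j if p(i,j) > 1/2 and A⁻ i j = 0 otherwise. Then A⁻ is acyclic and scoreSHD(A⁻) ≤ scoreSHD(A). -/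
/-- A matrix is acyclic if the transitive closure of its edge relation is irreflexive. -/
def MatAcyclic {p : ℕ} (A : Fin p → Fin p → ℝ) : Prop :=
  Irreflexive (Relation.TransGen fun i j => A i j = 1)

/-- Lemma from the proof of Proposition 7: dropping all edges of selection frequency
`≤ 1/2` from an acyclic 0/1 matrix keeps it acyclic and does not increase the SHD
aggregation score. -/
theorem scoreSHD_drop_low_freq {p B : ℕ} (hp : 1 ≤ p) (hB : 1 ≤ B)
    (E : Fin B → Fin p → Fin p → ℝ) (hE01 : ∀ b i j, E b i j = 0 ∨ E b i j = 1)
    (A : Fin p → Fin p → ℝ) (hA01 : ∀ i j, A i j = 0 ∨ A i j = 1)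
    (hAcyc : MatAcyclic A)
    (Aminus : Fin p → Fin p → ℝ)
    (hAminus : ∀ i j, Aminus i j = if 1 / 2 < selFreq E i j then A i j else 0) :
    MatAcyclic Aminus ∧ scoreSHD E Aminus ≤ scoreSHD E A := by
  constructor
  · intro i hi
    refine hAcyc i (Relation.TransGen.mono ?_ _ _ hi)
    intro a b hab
    change Aminus a b = 1 at hab
    rw [hAminus] at hab
    split_ifs at hab with h
    · exact hab
    · exact absurd hab (by norm_num)
  · have hB' : (0 : ℝ) < B := by exact_mod_cast hB
    have key : ∀ C : Fin p → Fin p → ℝ, ∑ b, ∑ i, ∑ j, |C i j - E b i j|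
        = ∑ i, ∑ j, ∑ b, |C i j - E b i j| := by
      intro C
      rw [Finset.sum_comm]
      refine Finset.sum_congr rfl fun i _ => ?_
      rw [Finset.sum_comm]
    unfold scoreSHD
    refine mul_le_mul_of_nonneg_left ?_ (by positivity)
    rw [key, key]
    refine Finset.sum_le_sum fun i _ => Finset.sum_le_sum fun j _ => ?_
    rw [hAminus]
    split_ifs with h
    · exact le_rfl
    rcases hA01 i j with h0 | h1
    · rw [h0]
    · rw [h1]
      have e0 : ∑ b, |0 - E b i j| = ∑ b, E b i j := by
        refine Finset.sum_congr rfl fun b _ => ?_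
        rcases hE01 b i j with h | h <;> rw [h] <;> norm_num
      have e1 : ∑ b, |1 - E b i j| = (B : ℝ) - ∑ b, E b i j := by
        have : ∑ b, |1 - E b i j| = ∑ b, (1 - E b i j) := by
          refine Finset.sum_congr rfl fun b _ => ?_
          rcases hE01 b i j with h | h <;> rw [h] <;> norm_num
        rw [this, Finset.sum_sub_distrib]
        simp
      rw [e0, e1]
      have h2 := not_lt.mp h
      unfold selFreq at h2
      rw [one_div_mul_eq_div, div_le_iff₀ hB'] at h2
      linarith
end

section
/- (Lemma from the proof of Proposition 7: monotonicity for high-frequency superset) Let A_1,…,A_B be an ensemble of 0/1 matrices, and let A and A* be 0/1 matrices such that every edge of A* has selection frequency above one half (A* i j = 1 implies p(i,j) > 1/2) and every edge of A is an edge of A* (A i j = 1 implies A* i j = 1). Then scoreSHD(A*) ≤ scoreSHD(A). -/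
/-- Lemma from the proof of Proposition 7: if every edge of `Astar` has selection
frequency above one half and `Astar` contains all the edges of `A`, then `Astar` has
SHD aggregation score no larger than `A`. -/
theorem scoreSHD_superset_high_freq {p B : ℕ} (hp : 1 ≤ p) (hB : 1 ≤ B)
    (E : Fin B → Fin p → Fin p → ℝ) (hE01 : ∀ b i j, E b i j = 0 ∨ E b i j = 1)
    (A Astar : Fin p → Fin p → ℝ)
    (hA01 : ∀ i j, A i j = 0 ∨ A i j = 1)
    (hAstar01 : ∀ i j, Astar i j = 0 ∨ Astar i j = 1)
    (hHigh : ∀ i j, Astar i j = 1 → 1 / 2 < selFreq E i j)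
    (hSub : ∀ i j, A i j = 1 → Astar i j = 1) :
    scoreSHD E Astar ≤ scoreSHD E A := by
  have hBpos : (0 : ℝ) < B := by exact_mod_cast hB
  have key : ∀ i j, ∑ b, |Astar i j - E b i j| ≤ ∑ b, |A i j - E b i j| := by
    intro i j
    rcases hA01 i j with hA | hA
    · rcases hAstar01 i j with hS | hS
      · rw [hA, hS]
      · have h := hHigh i j hS
        unfold selFreq at h
        have e1 : ∀ b, |Astar i j - E b i j| = 1 - E b i j := by
          intro b
          rcases hE01 b i j with h0 | h0 <;> simp [hS, h0]
        have e2 : ∀ b, |A i j - E b i j| = E b i j := by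
          intro b
          rcases hE01 b i j with h0 | h0 <;> simp [hA, h0]
        simp only [e1, e2, Finset.sum_sub_distrib]
        rw [one_div_mul_eq_div, lt_div_iff₀ hBpos] at h
        simp only [Finset.sum_const, Finset.card_univ, Fintype.card_fin, nsmul_eq_mul, mul_one]
        linarith
    · rw [hA, hSub i j hA]
  have swap : ∀ M : Fin p → Fin p → ℝ, ∑ b, ∑ i, ∑ j, |M i j - E b i j|
      = ∑ i, ∑ j, ∑ b, |M i j - E b i j| := by
    intro M
    rw [Finset.sum_comm]
    exact Finset.sum_congr rfl fun i _ => Finset.sum_comm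
  unfold scoreSHD
  rw [swap, swap]
  exact mul_le_mul_of_nonneg_left
    (Finset.sum_le_sum fun i _ => Finset.sum_le_sum fun j _ => key i j) (by positivity)
end

section
/- (Proposition 7, one blocked edge) Let A_1,…,A_B be an ensemble of 0/1 matrices, and let E⁺ = {(i,j) : p(i,j) > 1/2}. Suppose there is a pair c = (c₁,c₂) ∈ E⁺ such that: (a) the 0/1 matrix A* whose edge set is E⁺ \ {c} is acyclic; and (b) the relation whose edges are {e ∈ E⁺ : p(e) ≥ p(c)} (a set which contains c) is not acyclic, i.e., its transitive closure fails to be irreflexive. Then scoreSHD(A*) ≤ scoreSHD(A) for every acyclic 0/1 matrix A on the same node set. -/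
theorem scoreSHD_eq_aux {p B : ℕ} (hB : 1 ≤ B)
    (E : Fin B → Fin p → Fin p → ℝ) (hE01 : ∀ b i j, E b i j = 0 ∨ E b i j = 1)
    (A : Fin p → Fin p → ℝ) (hA : ∀ i j, A i j = 0 ∨ A i j = 1) :
    scoreSHD E A = ∑ x : Fin p × Fin p,
      (selFreq E x.1 x.2 + A x.1 x.2 * (1 - 2 * selFreq E x.1 x.2)) := by
  have hB' : (B : ℝ) ≠ 0 := by positivity
  have h1 : ∀ b i j, |A i j - E b i j| = A i j + (1 - 2 * A i j) * E b i j := by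
    intro b i j
    rcases hA i j with h | h <;> rcases hE01 b i j with h' | h' <;> rw [h, h'] <;> norm_num
  unfold scoreSHD
  rw [Fintype.sum_prod_type, Finset.sum_comm, Finset.mul_sum]
  refine Finset.sum_congr rfl fun i _ => ?_
  rw [Finset.sum_comm, Finset.mul_sum]
  refine Finset.sum_congr rfl fun j _ => ?_
  simp only [h1, Finset.sum_add_distrib, ← Finset.mul_sum, selFreq]
  simp only [Finset.sum_const, Finset.card_univ, Fintype.card_fin, nsmul_eq_mul]
  field_simp
  ring

/-- Proposition 7 (one blocked edge): suppose `c = (c₁, c₂)` is an edge with selection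
frequency `> 1/2` such that the graph `Astar` on all edges of frequency `> 1/2` except
`c` is acyclic, while the graph on the edges of frequency `> 1/2` that have frequency at
least that of `c` is not acyclic.  Then `Astar` minimizes the SHD aggregation score among
all acyclic 0/1 matrices. -/
theorem scoreSHD_global_min_one_blocked {p B : ℕ} (hp : 1 ≤ p) (hB : 1 ≤ B)
    (E : Fin B → Fin p → Fin p → ℝ) (hE01 : ∀ b i j, E b i j = 0 ∨ E b i j = 1)
    (c₁ c₂ : Fin p) (hc : 1 / 2 < selFreq E c₁ c₂)
    (Astar : Fin p → Fin p → ℝ)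
    (hAstar : ∀ i j,
      Astar i j = if 1 / 2 < selFreq E i j ∧ (i, j) ≠ (c₁, c₂) then 1 else 0)
    (hAcyc : MatAcyclic Astar)
    (hBlocked : ¬ Irreflexive (Relation.TransGen
      (fun i j => 1 / 2 < selFreq E i j ∧ selFreq E c₁ c₂ ≤ selFreq E i j))) :
    ∀ A : Fin p → Fin p → ℝ, (∀ i j, A i j = 0 ∨ A i j = 1) → MatAcyclic A →
      scoreSHD E Astar ≤ scoreSHD E A := by
  intro A hA hAc
  have hex : ∃ u v, 1 / 2 < selFreq E u v ∧ selFreq E c₁ c₂ ≤ selFreq E u v ∧ A u v = 0 := by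
    by_contra hne
    apply hBlocked
    intro x hx
    refine hAc x (Relation.TransGen.mono ?_ _ _ hx)
    intro i j hij
    rcases hA i j with h | h
    · exact absurd ⟨i, j, hij.1, hij.2, h⟩ hne
    · exact h
  obtain ⟨u, v, huv, hcuv, hAuv⟩ := hex
  have hS : ∀ i j, Astar i j = 0 ∨ Astar i j = 1 := by
    intro i j
    rw [hAstar]
    split_ifs <;> simp
  rw [scoreSHD_eq_aux hB E hE01 A hA, scoreSHD_eq_aux hB E hE01 Astar hS]
  have key : ∑ x : Fin p × Fin p,
      ((selFreq E x.1 x.2 + Astar x.1 x.2 * (1 - 2 * selFreq E x.1 x.2))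
        - (if x = (c₁, c₂) then 2 * selFreq E c₁ c₂ - 1 else 0)) ≤
      ∑ x : Fin p × Fin p,
      ((selFreq E x.1 x.2 + A x.1 x.2 * (1 - 2 * selFreq E x.1 x.2))
        - (if x = (u, v) then 2 * selFreq E u v - 1 else 0)) := by
    refine Finset.sum_le_sum ?_
    rintro ⟨i, j⟩ -
    have hl : Astar i j * (1 - 2 * selFreq E i j)
        - (if (i, j) = (c₁, c₂) then 2 * selFreq E c₁ c₂ - 1 else 0)
        = min 0 (1 - 2 * selFreq E i j) := by
      rw [hAstar]
      by_cases h : (i, j) = (c₁, c₂)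
      · obtain ⟨rfl, rfl⟩ := Prod.mk.inj h
        rw [min_eq_right (by linarith)]
        simp
      · by_cases h2 : 1 / 2 < selFreq E i j
        · rw [min_eq_right (by linarith), if_pos ⟨h2, h⟩, if_neg h]
          ring
        · rw [min_eq_left (by linarith), if_neg (fun h3 => h2 h3.1), if_neg h]
          ring
    have hr : min 0 (1 - 2 * selFreq E i j) ≤ A i j * (1 - 2 * selFreq E i j)
        - (if (i, j) = (u, v) then 2 * selFreq E u v - 1 else 0) := by
      by_cases h : (i, j) = (u, v)
      · obtain ⟨rfl, rfl⟩ := Prod.mk.inj h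
        rw [if_pos rfl, hAuv]
        refine (min_le_right _ _).trans (by linarith)
      · rw [if_neg h]
        rcases hA i j with h | h <;> rw [h] <;> simp
    dsimp only
    linarith
  rw [Finset.sum_sub_distrib, Finset.sum_sub_distrib, Finset.sum_ite_eq' Finset.univ,
    Finset.sum_ite_eq' Finset.univ] at key
  simp only [Finset.mem_univ, if_true] at key
  linarith
end

section
/- (GSHD is a metric) Fix a real α with 0 < α ≤ 2. On the set of 0/1 matrices on Fin p with zero diagonal and no 2-cycles, d_GSHD(α) is a metric: for all such matrices A, Ã, C one has d_GSHD(α)(A,Ã) ≥ 0; d_GSHD(α)(A,Ã) = 0 if and only if A = Ã; d_GSHD(α)(A,Ã) = d_GSHD(α)(Ã,A); and d_GSHD(α)(A,C) ≤ d_GSHD(α)(A,Ã) + d_GSHD(α)(Ã,C). -/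
/-- Generalized structural Hamming distance with reversal weight `α` between two
adjacency matrices: summing over unordered pairs `i < j`, a pair contributes `0` if the
two matrices agree on both `(i,j)` and `(j,i)`, `1` if they differ in exactly one of the
two entries, and `α` if they differ in both. -/
noncomputable def dGSHD {p : ℕ} (α : ℝ) (A A' : Fin p → Fin p → ℝ) : ℝ :=
  ∑ ij ∈ Finset.univ.filter (fun ij : Fin p × Fin p => ij.1 < ij.2),
    (if |A ij.1 ij.2 - A' ij.1 ij.2| + |A ij.2 ij.1 - A' ij.2 ij.1| = 0 then 0
     else if |A ij.1 ij.2 - A' ij.1 ij.2| + |A ij.2 ij.1 - A' ij.2 ij.1| = 1 then 1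
     else α)

/-- `A` is a 0/1 adjacency matrix with zero diagonal and no 2-cycles. -/
def IsDAGAdj {p : ℕ} (A : Fin p → Fin p → ℝ) : Prop :=
  (∀ i j, A i j = 0 ∨ A i j = 1) ∧ (∀ i, A i i = 0) ∧
    (∀ i j, i ≠ j → A i j + A j i ≤ 1)

noncomputable def gTerm (α a b c d : ℝ) : ℝ :=
  if |a - c| + |b - d| = 0 then 0 else if |a - c| + |b - d| = 1 then 1 else α

theorem gTerm_nonneg (α a b c d : ℝ) (h : 0 < α) : 0 ≤ gTerm α a b c d := by
  unfold gTerm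
  split_ifs <;> linarith

theorem gTerm_comm (α a b c d : ℝ) : gTerm α a b c d = gTerm α c d a b := by
  unfold gTerm
  rw [abs_sub_comm a c, abs_sub_comm b d]

theorem gTerm_eq_zero (α a b c d : ℝ) (h : 0 < α) (h0 : gTerm α a b c d = 0) :
    a = c ∧ b = d := by
  unfold gTerm at h0
  split_ifs at h0 with h1 h2
  · have := abs_nonneg (a - c)
    have := abs_nonneg (b - d)
    have e1 : |a - c| = 0 := by linarith
    have e2 : |b - d| = 0 := by linarith
    rw [abs_eq_zero] at e1 e2
    constructor <;> linarith
  · norm_num at h0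
  · linarith

theorem gTerm_triangle (α a b c d e f : ℝ) (h : 0 < α) (h2 : α ≤ 2)
    (ha : a = 0 ∨ a = 1) (hb : b = 0 ∨ b = 1) (hc : c = 0 ∨ c = 1)
    (hd : d = 0 ∨ d = 1) (he : e = 0 ∨ e = 1) (hf : f = 0 ∨ f = 1)
    (hab : a + b ≤ 1) (hcd : c + d ≤ 1) (hef : e + f ≤ 1) :
    gTerm α a b e f ≤ gTerm α a b c d + gTerm α c d e f := by
  unfold gTerm
  rcases ha with rfl | rfl <;> rcases hb with rfl | rfl <;> rcases hc with rfl | rfl <;>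
  rcases hd with rfl | rfl <;> rcases he with rfl | rfl <;> rcases hf with rfl | rfl <;>
  first
  | (exfalso; linarith)
  | (norm_num; done)
  | (norm_num; linarith)

theorem dGSHD_eq {p : ℕ} (α : ℝ) (A B : Fin p → Fin p → ℝ) :
    dGSHD α A B = ∑ ij ∈ Finset.univ.filter (fun ij : Fin p × Fin p => ij.1 < ij.2),
      gTerm α (A ij.1 ij.2) (A ij.2 ij.1) (B ij.1 ij.2) (B ij.2 ij.1) := rfl

/-- For `0 < α ≤ 2`, the generalized structural Hamming distance `dGSHD α` is a metric
on the set of 0/1 adjacency matrices with zero diagonal and no 2-cycles. -/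
theorem dGSHD_is_metric {p : ℕ} (α : ℝ) (hα : 0 < α ∧ α ≤ 2)
    (A A' C : Fin p → Fin p → ℝ)
    (hA : IsDAGAdj A) (hA' : IsDAGAdj A') (hC : IsDAGAdj C) :
    0 ≤ dGSHD α A A' ∧
    (dGSHD α A A' = 0 ↔ A = A') ∧
    dGSHD α A A' = dGSHD α A' A ∧
    dGSHD α A C ≤ dGSHD α A A' + dGSHD α A' C := by
  obtain ⟨h0, h2⟩ := hα
  simp only [dGSHD_eq]
  refine ⟨Finset.sum_nonneg fun _ _ => gTerm_nonneg _ _ _ _ _ h0, ⟨fun h => ?_, ?_⟩,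
    Finset.sum_congr rfl fun _ _ => gTerm_comm _ _ _ _ _, ?_⟩
  · rw [Finset.sum_eq_zero_iff_of_nonneg fun _ _ => gTerm_nonneg _ _ _ _ _ h0] at h
    have key : ∀ i j, i < j → A i j = A' i j ∧ A j i = A' j i := fun i j hij =>
      gTerm_eq_zero _ _ _ _ _ h0 (h (i, j) (by simpa using hij))
    funext i j
    rcases lt_trichotomy i j with hij | hij | hij
    · exact (key i j hij).1
    · subst hij
      rw [hA.2.1, hA'.2.1]
    · exact (key j i hij).2
  · rintro rfl
    exact Finset.sum_eq_zero fun _ _ => by simp [gTerm]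
  · rw [← Finset.sum_add_distrib]
    refine Finset.sum_le_sum fun ij hij => ?_
    have hne : ij.1 ≠ ij.2 := ne_of_lt (by simpa using hij)
    exact gTerm_triangle _ _ _ _ _ _ _ h0 h2 (hA.1 _ _) (hA.1 _ _) (hA'.1 _ _) (hA'.1 _ _)
      (hC.1 _ _) (hC.1 _ _) (hA.2.2 _ _ hne) (hA'.2.2 _ _ hne) (hC.2.2 _ _ hne)
end

section
/- (Proposition 8) Fix α > 0. Let A and the ensemble matrices A_1,…,A_B all be 0/1 matrices with zero diagonal and no 2-cycles. Then scoreGSHD(α)(A) = Σ_{(i,j) : A i j = 1} (1 − 2·gp(i,j)) + Σ_{i,j} p(i,j), where the second sum ranges over all ordered pairs (i,j) of nodes. -/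
/-- Generalized selection frequency of the ordered pair `(i, j)`. -/
noncomputable def gselFreq {p B : ℕ} (α : ℝ) (E : Fin B → Fin p → Fin p → ℝ)
    (i j : Fin p) : ℝ :=
  selFreq E i j + (1 - α / 2) * selFreq E j i

/-- GSHD aggregation score of the matrix `A` with respect to the ensemble `E`. -/
noncomputable def scoreGSHD {p B : ℕ} (α : ℝ) (E : Fin B → Fin p → Fin p → ℝ)
    (A : Fin p → Fin p → ℝ) : ℝ :=
  (1 / (B : ℝ)) * ∑ b, dGSHD α A (E b)

theorem sum_pairs_symm_aux {p : ℕ} (f : Fin p → Fin p → ℝ) (h0 : ∀ i, f i i = 0) :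
    ∑ ij ∈ Finset.univ.filter (fun ij : Fin p × Fin p => ij.1 < ij.2),
      (f ij.1 ij.2 + f ij.2 ij.1) = ∑ i, ∑ j, f i j := by
  rw [Finset.sum_filter, Fintype.sum_prod_type]
  have h1 : ∀ i j : Fin p, (if i < j then f i j + f j i else 0)
      = (if i < j then f i j else 0) + (if i < j then f j i else 0) := by
    intro i j; split_ifs <;> simp
  simp only [h1, Finset.sum_add_distrib]
  rw [Finset.sum_comm (f := fun i j => if i < j then f j i else 0)]
  simp only [← Finset.sum_add_distrib]
  refine Finset.sum_congr rfl fun i _ => Finset.sum_congr rfl fun j _ => ?_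
  rcases lt_trichotomy i j with h | h | h
  · simp [h, h.not_gt]
  · subst h; simp [h0]
  · simp [h, h.not_gt]

theorem dGSHD_eq_aux {p : ℕ} (α : ℝ) (A A' : Fin p → Fin p → ℝ) (hA : IsDAGAdj A)
    (hA' : IsDAGAdj A') :
    dGSHD α A A' = ∑ i, ∑ j, (A i j * (1 - 2 * (A' i j + (1 - α / 2) * A' j i)) + A' i j) := by
  rw [← sum_pairs_symm_aux _ (fun i => by simp [hA.2.1 i, hA'.2.1 i])]
  unfold dGSHD
  refine Finset.sum_congr rfl fun ij hij => ?_
  obtain ⟨i, j⟩ := ij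
  have hne : i ≠ j := by
    simp only [Finset.mem_filter] at hij
    exact hij.2.ne
  have a1 := hA.2.2 i j hne
  have a2 := hA'.2.2 i j hne
  dsimp only
  rcases hA.1 i j with h1 | h1 <;> rcases hA.1 j i with h2 | h2 <;>
    rcases hA'.1 i j with h3 | h3 <;> rcases hA'.1 j i with h4 | h4 <;>
    rw [h1, h2] at a1 <;> rw [h3, h4] at a2 <;> rw [h1, h2, h3, h4] <;>
    first
    | (exfalso; linarith)
    | (norm_num; done)
    | (norm_num; ring)

/-- Proposition 8: the GSHD aggregation score in terms of (generalized) selection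
frequencies. -/
theorem scoreGSHD_eq_gselFreq {p B : ℕ} (hp : 1 ≤ p) (hB : 1 ≤ B) (α : ℝ) (hα : 0 < α)
    (A : Fin p → Fin p → ℝ) (hA : IsDAGAdj A)
    (E : Fin B → Fin p → Fin p → ℝ) (hE : ∀ b, IsDAGAdj (E b)) :
    scoreGSHD α E A =
      (∑ ij ∈ Finset.univ.filter (fun ij : Fin p × Fin p => A ij.1 ij.2 = 1),
        (1 - 2 * gselFreq α E ij.1 ij.2)) +
      ∑ i, ∑ j, selFreq E i j := by
  have hB0 : (B : ℝ) ≠ 0 := by positivity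
  have hG : ∀ i j, gselFreq α E i j
      = (1 / (B : ℝ)) * ∑ b, (E b i j + (1 - α / 2) * E b j i) := by
    intro i j
    simp only [gselFreq, selFreq, Finset.sum_add_distrib, ← Finset.mul_sum]
    ring
  have hR : ∑ ij ∈ Finset.univ.filter (fun ij : Fin p × Fin p => A ij.1 ij.2 = 1),
        (1 - 2 * gselFreq α E ij.1 ij.2)
      = ∑ i, ∑ j, A i j * (1 - 2 * gselFreq α E i j) := by
    rw [Finset.sum_filter, Fintype.sum_prod_type]
    refine Finset.sum_congr rfl fun i _ => Finset.sum_congr rfl fun j _ => ?_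
    rcases hA.1 i j with h | h <;> simp [h]
  rw [hR]
  simp only [← Finset.sum_add_distrib]
  unfold scoreGSHD
  rw [Finset.sum_congr rfl fun b _ => dGSHD_eq_aux α A (E b) hA (hE b), Finset.sum_comm,
    Finset.mul_sum]
  refine Finset.sum_congr rfl fun i _ => ?_
  rw [Finset.sum_comm, Finset.mul_sum]
  refine Finset.sum_congr rfl fun j _ => ?_
  rw [hG, selFreq, Finset.sum_add_distrib, ← Finset.mul_sum, Finset.sum_sub_distrib,
    ← Finset.mul_sum]
  simp only [Finset.sum_const, Finset.card_univ, Fintype.card_fin, nsmul_eq_mul, mul_one]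
  field_simp
end

section
/- (Proposition 9, edge addition) Fix α > 0. Let A and the ensemble matrices A_1,…,A_B be 0/1 matrices with zero diagonal and no 2-cycles, let i ≠ j satisfy A i j = 0 and A j i = 0, and let A' agree with A everywhere except A' i j = 1. Then scoreGSHD(α)(A') − scoreGSHD(α)(A) = 1 − 2·gp(i,j). In particular, if gp(i,j) ≤ 1/2 then scoreGSHD(α)(A') ≥ scoreGSHD(α)(A). -/
theorem dGSHD_add_edge_aux {p : ℕ} (α : ℝ)
    (A A' M : Fin p → Fin p → ℝ) (hM : IsDAGAdj M)
    (i j : Fin p) (hne : i ≠ j) (hij : A i j = 0) (hji : A j i = 0)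
    (hA'ij : A' i j = 1) (hA' : ∀ k l, (k, l) ≠ (i, j) → A' k l = A k l) :
    dGSHD α A' M - dGSHD α A M = 1 - 2 * (M i j + (1 - α / 2) * M j i) := by
  have hA'ji : A' j i = 0 := by
    rw [hA' j i (by simp [hne.symm]), hji]
  obtain ⟨h01, -, h2⟩ := hM
  have h2 := h2 i j hne
  unfold dGSHD
  rw [← Finset.sum_sub_distrib]
  rcases lt_or_gt_of_ne hne with hlt | hlt
  · rw [Finset.sum_eq_single (i, j)]
    · simp only [hij, hji, hA'ij, hA'ji]
      rcases h01 i j with h | h <;> rcases h01 j i with h' | h' <;>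
        first | (exfalso; rw [h, h'] at h2; norm_num at h2; done) | (simp only [h, h']; norm_num; done) | (simp only [h, h']; norm_num; ring)
    · rintro ⟨k, l⟩ hk hn
      simp only [Finset.mem_filter, Finset.mem_univ, true_and] at hk
      have h' : (l, k) ≠ (i, j) := by
        intro h
        simp only [Prod.mk.injEq] at h
        rw [h.1, h.2] at hk
        exact absurd hk (not_lt.mpr hlt.le)
      simp only [hA' k l hn, hA' l k h', sub_self]
    · intro h
      simp [hlt] at h
  · rw [Finset.sum_eq_single (j, i)]
    · simp only [hij, hji, hA'ij, hA'ji]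
      rcases h01 i j with h | h <;> rcases h01 j i with h' | h' <;>
        first | (exfalso; rw [h, h'] at h2; norm_num at h2; done) | (simp only [h, h']; norm_num; done) | (simp only [h, h']; norm_num; ring)
    · rintro ⟨k, l⟩ hk hn
      simp only [Finset.mem_filter, Finset.mem_univ, true_and] at hk
      have h1 : (k, l) ≠ (i, j) := by
        intro h
        simp only [Prod.mk.injEq] at h
        rw [h.1, h.2] at hk
        exact absurd hk (not_lt.mpr hlt.le)
      have h' : (l, k) ≠ (i, j) := by
        intro h
        simp only [Prod.mk.injEq] at h
        exact hn (by rw [h.1, h.2])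
      simp only [hA' k l h1, hA' l k h', sub_self]
    · intro h
      simp [hlt] at h

/-- Proposition 9, edge addition: adding the edge `(i, j)` (with `i ≠ j`, no edge between
`i` and `j` in either direction) changes the GSHD aggregation score by `1 - 2 * gp(i,j)`;
in particular if `gp(i,j) ≤ 1/2` the score does not decrease. -/
theorem scoreGSHD_add_edge {p B : ℕ} (hp : 1 ≤ p) (hB : 1 ≤ B) (α : ℝ) (hα : 0 < α)
    (A A' : Fin p → Fin p → ℝ) (hA : IsDAGAdj A)
    (E : Fin B → Fin p → Fin p → ℝ) (hE : ∀ b, IsDAGAdj (E b))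
    (i j : Fin p) (hne : i ≠ j) (hij : A i j = 0) (hji : A j i = 0)
    (hA'ij : A' i j = 1) (hA' : ∀ k l, (k, l) ≠ (i, j) → A' k l = A k l) :
    scoreGSHD α E A' - scoreGSHD α E A = 1 - 2 * gselFreq α E i j ∧
      (gselFreq α E i j ≤ 1 / 2 → scoreGSHD α E A ≤ scoreGSHD α E A') := by
  have key : scoreGSHD α E A' - scoreGSHD α E A = 1 - 2 * gselFreq α E i j := by
    have hB' : (B : ℝ) ≠ 0 := by
      have : B ≠ 0 := by omega
      exact_mod_cast this
    unfold scoreGSHD gselFreq selFreq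
    rw [← mul_sub, ← Finset.sum_sub_distrib,
      Finset.sum_congr rfl (fun b _ =>
        dGSHD_add_edge_aux α A A' (E b) (hE b) i j hne hij hji hA'ij hA')]
    rw [Finset.sum_sub_distrib, ← Finset.mul_sum, Finset.sum_add_distrib, ← Finset.mul_sum]
    simp only [Finset.sum_const, Finset.card_univ, Fintype.card_fin, nsmul_eq_mul, mul_one]
    field_simp
  exact ⟨key, fun h => by linarith⟩
end

section
/- (Proposition 9, edge deletion) Fix α > 0. Let A and the ensemble matrices A_1,…,A_B be 0/1 matrices with zero diagonal and no 2-cycles, let (i,j) satisfy A i j = 1, and let A' agree with A everywhere except A' i j = 0. Then scoreGSHD(α)(A') − scoreGSHD(α)(A) = 2·gp(i,j) − 1. In particular, if gp(i,j) > 1/2 then scoreGSHD(α)(A') > scoreGSHD(α)(A). -/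
/-- Per-graph change of the distance. -/
lemma dGSHD_delete_aux {p : ℕ} (α : ℝ) (A A' C : Fin p → Fin p → ℝ) (hA : IsDAGAdj A)
    (hC : IsDAGAdj C) (i j : Fin p) (hij : A i j = 1)
    (hA'ij : A' i j = 0) (hA' : ∀ k l, (k, l) ≠ (i, j) → A' k l = A k l) :
    dGSHD α A' C - dGSHD α A C = 2 * (C i j + (1 - α / 2) * C j i) - 1 := by
  have hne : i ≠ j := by
    rintro rfl
    have := hA.2.1 i
    linarith
  have hji : A j i = 0 := by
    have h := hA.2.2 i j hne
    rcases hA.1 j i with h0 | h0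
    · exact h0
    · linarith
  have hji' : A' j i = 0 := by
    rw [hA' j i (by simp [hne]), hji]
  have hc := hC.2.2 i j hne
  unfold dGSHD
  rw [← Finset.sum_sub_distrib]
  rcases lt_or_gt_of_ne hne with hlt | hlt
  · rw [Finset.sum_eq_single (i, j)]
    · simp only [hij, hji, hji', hA'ij]
      rcases hC.1 i j with h1 | h1 <;> rcases hC.1 j i with h2 | h2 <;>
        rw [h1, h2] at hc ⊢ <;> first | (exfalso; norm_num at hc; done) | (clear hc; norm_num)
      ring
    · rintro ⟨k, l⟩ hkl hn
      have hkl' : k < l := by simpa using hkl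
      have e1 := hA' k l hn
      have e2 := hA' l k (by rintro ⟨⟩; exact absurd hlt (not_lt.mpr hkl'.le))
      simp only [e1, e2, sub_self]
    · intro h
      simp [hlt] at h
  · rw [Finset.sum_eq_single (j, i)]
    · simp only [hij, hji, hji', hA'ij]
      rcases hC.1 i j with h1 | h1 <;> rcases hC.1 j i with h2 | h2 <;>
        rw [h1, h2] at hc ⊢ <;> first | (exfalso; norm_num at hc; done) | (clear hc; norm_num)
      ring
    · rintro ⟨k, l⟩ hkl hn
      have hkl' : k < l := by simpa using hkl
      have e1 := hA' k l (by rintro ⟨⟩; exact absurd hlt (not_lt.mpr hkl'.le))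
      have e2 := hA' l k (by rintro ⟨⟩; exact hn rfl)
      simp only [e1, e2, sub_self]
    · intro h
      simp [hlt] at h

/-- Proposition 9, edge deletion: deleting the edge `(i, j)` changes the GSHD aggregation
score by `2 * gp(i,j) - 1`; in particular if `gp(i,j) > 1/2` the score strictly
increases. -/
theorem scoreGSHD_delete_edge {p B : ℕ} (hp : 1 ≤ p) (hB : 1 ≤ B) (α : ℝ) (hα : 0 < α)
    (A A' : Fin p → Fin p → ℝ) (hA : IsDAGAdj A)
    (E : Fin B → Fin p → Fin p → ℝ) (hE : ∀ b, IsDAGAdj (E b))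
    (i j : Fin p) (hij : A i j = 1)
    (hA'ij : A' i j = 0) (hA' : ∀ k l, (k, l) ≠ (i, j) → A' k l = A k l) :
    scoreGSHD α E A' - scoreGSHD α E A = 2 * gselFreq α E i j - 1 ∧
      (1 / 2 < gselFreq α E i j → scoreGSHD α E A < scoreGSHD α E A') := by
  have key : scoreGSHD α E A' - scoreGSHD α E A = 2 * gselFreq α E i j - 1 := by
    have hB0 : (B : ℝ) ≠ 0 := by
      have : B ≠ 0 := by omega
      exact_mod_cast this
    unfold scoreGSHD gselFreq selFreq
    rw [← mul_sub, ← Finset.sum_sub_distrib,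
      Finset.sum_congr rfl (fun b _ => dGSHD_delete_aux α A A' (E b) hA (hE b) i j hij hA'ij hA'),
      Finset.sum_sub_distrib, ← Finset.mul_sum, Finset.sum_add_distrib, ← Finset.mul_sum]
    simp only [Finset.sum_const, Finset.card_univ, Fintype.card_fin, nsmul_eq_mul, mul_one]
    field_simp
  exact ⟨key, fun h => by linarith⟩
end

section
/- (From the proof of Proposition 9: edge reversal) Fix α > 0. Let A and the ensemble matrices A_1,…,A_B be 0/1 matrices with zero diagonal and no 2-cycles, let i ≠ j satisfy A i j = 1 and A j i = 0, and let A' agree with A everywhere except A' i j = 0 and A' j i = 1. Then scoreGSHD(α)(A') − scoreGSHD(α)(A) = 2·(gp(i,j) − gp(j,i)). -/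
theorem dGSHD_reverse_aux {p : ℕ} (α : ℝ) (A A' F : Fin p → Fin p → ℝ) (hF : IsDAGAdj F)
    (i j : Fin p) (hne : i ≠ j) (hij : A i j = 1) (hji : A j i = 0)
    (hA'ij : A' i j = 0) (hA'ji : A' j i = 1)
    (hA' : ∀ k l, (k, l) ≠ (i, j) → (k, l) ≠ (j, i) → A' k l = A k l) :
    dGSHD α A' F - dGSHD α A F = α * (F i j - F j i) := by
  obtain ⟨h01, -, h2⟩ := hF
  have h2 := h2 i j hne
  unfold dGSHD
  rw [← Finset.sum_sub_distrib]
  have key : ∀ m : Fin p × Fin p, m.1 < m.2 → m ≠ (i, j) → m ≠ (j, i) →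
      A' m.1 m.2 = A m.1 m.2 ∧ A' m.2 m.1 = A m.2 m.1 := by
    rintro ⟨k, l⟩ _ h1 h3
    refine ⟨hA' k l h1 h3, hA' l k ?_ ?_⟩
    · intro h; apply h3; simp only [Prod.mk.injEq] at h ⊢; exact ⟨h.2, h.1⟩
    · intro h; apply h1; simp only [Prod.mk.injEq] at h ⊢; exact ⟨h.2, h.1⟩
  rcases lt_or_gt_of_ne hne with hlt | hlt
  · rw [Finset.sum_eq_single (i, j)]
    · simp only [hij, hji, hA'ij, hA'ji]
      rcases h01 i j with h | h <;> rcases h01 j i with h' | h' <;> rw [h, h'] at * <;> norm_num at *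
    · intro m hm hm1
      have hm := (Finset.mem_filter.1 hm).2
      obtain ⟨e1, e2⟩ := key m hm hm1 (by rintro rfl; exact lt_asymm hlt hm)
      rw [e1, e2, sub_self]
    · intro h; exact (h (Finset.mem_filter.2 ⟨Finset.mem_univ _, hlt⟩)).elim
  · rw [Finset.sum_eq_single (j, i)]
    · simp only [hij, hji, hA'ij, hA'ji]
      rcases h01 i j with h | h <;> rcases h01 j i with h' | h' <;> rw [h, h'] at * <;> norm_num at *
    · intro m hm hm1
      have hm := (Finset.mem_filter.1 hm).2
      obtain ⟨e1, e2⟩ := key m hm (by rintro rfl; exact lt_asymm hlt hm) hm1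
      rw [e1, e2, sub_self]
    · intro h; exact (h (Finset.mem_filter.2 ⟨Finset.mem_univ _, hlt⟩)).elim

/-- From the proof of Proposition 9, edge reversal: reversing the edge `(i, j)` changes
the GSHD aggregation score by `2 * (gp(i,j) - gp(j,i))`. -/
theorem scoreGSHD_reverse_edge {p B : ℕ} (hp : 1 ≤ p) (hB : 1 ≤ B) (α : ℝ) (hα : 0 < α)
    (A A' : Fin p → Fin p → ℝ) (hA : IsDAGAdj A)
    (E : Fin B → Fin p → Fin p → ℝ) (hE : ∀ b, IsDAGAdj (E b))
    (i j : Fin p) (hne : i ≠ j) (hij : A i j = 1) (hji : A j i = 0)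
    (hA'ij : A' i j = 0) (hA'ji : A' j i = 1)
    (hA' : ∀ k l, (k, l) ≠ (i, j) → (k, l) ≠ (j, i) → A' k l = A k l) :
    scoreGSHD α E A' - scoreGSHD α E A =
      2 * (gselFreq α E i j - gselFreq α E j i) := by
  have h : ∑ b, dGSHD α A' (E b) - ∑ b, dGSHD α A (E b) =
      α * (∑ b, E b i j - ∑ b, E b j i) := by
    rw [← Finset.sum_sub_distrib, ← Finset.sum_sub_distrib, Finset.mul_sum]
    exact Finset.sum_congr rfl fun b _ =>
      dGSHD_reverse_aux α A A' (E b) (hE b) i j hne hij hji hA'ij hA'ji hA'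
  unfold scoreGSHD gselFreq selFreq
  rw [← mul_sub, h]
  ring
end

section
/- (Proposition 9, global optimality with no blocked edge) Fix α > 0. Let the ensemble matrices A_1,…,A_B be 0/1 matrices with zero diagonal and no 2-cycles, and define the 0/1 matrix A* by A* i j = 1 if gp(i,j) > 1/2 and A* i j = 0 otherwise. If A* is acyclic, then scoreGSHD(α)(A*) ≤ scoreGSHD(α)(A) for every acyclic 0/1 matrix A with zero diagonal and no 2-cycles. -/
lemma pair_cost (α a a' x y : ℝ) (ha : a = 0 ∨ a = 1) (ha' : a' = 0 ∨ a' = 1)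
    (hx : x = 0 ∨ x = 1) (hy : y = 0 ∨ y = 1) (h1 : a + a' ≤ 1) (h2 : x + y ≤ 1) :
    (if |a - x| + |a' - y| = 0 then 0 else if |a - x| + |a' - y| = 1 then 1 else α) =
      x + y + a * (1 - 2 * x - (2 - α) * y) + a' * (1 - 2 * y - (2 - α) * x) := by
  rcases ha with rfl | rfl <;> rcases ha' with rfl | rfl <;> rcases hx with rfl | rfl <;>
    rcases hy with rfl | rfl <;> first
    | (exfalso; linarith)
    | (norm_num; done)
    | (norm_num; ring)

lemma score_eq {p B : ℕ} (hB : 1 ≤ B) (α : ℝ)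
    (E : Fin B → Fin p → Fin p → ℝ) (hE : ∀ b, IsDAGAdj (E b))
    (A : Fin p → Fin p → ℝ) (hA : IsDAGAdj A) :
    scoreGSHD α E A = ∑ ij ∈ Finset.univ.filter (fun ij : Fin p × Fin p => ij.1 < ij.2),
      (selFreq E ij.1 ij.2 + selFreq E ij.2 ij.1
        + A ij.1 ij.2 * (1 - 2 * gselFreq α E ij.1 ij.2)
        + A ij.2 ij.1 * (1 - 2 * gselFreq α E ij.2 ij.1)) := by
  have hB' : (B : ℝ) ≠ 0 := by
    have : B ≠ 0 := by omega
    exact_mod_cast this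
  unfold scoreGSHD dGSHD
  rw [Finset.sum_comm, Finset.mul_sum]
  refine Finset.sum_congr rfl ?_
  rintro ⟨i, j⟩ hij
  have hij : i < j := by simpa using hij
  have key : ∀ b, _ := fun b => pair_cost α (A i j) (A j i) (E b i j) (E b j i) (hA.1 i j)
    (hA.1 j i) ((hE b).1 i j) ((hE b).1 j i) (hA.2.2 i j hij.ne) ((hE b).2.2 i j hij.ne)
  simp only [key]
  simp only [Finset.sum_add_distrib, ← Finset.mul_sum, Finset.sum_sub_distrib]
  simp only [gselFreq, selFreq, Finset.sum_const, Finset.card_univ, Fintype.card_fin,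
    nsmul_eq_mul]
  field_simp
  ring

/-- Proposition 9, global optimality with no blocked edge: if the graph consisting of
all edges with generalized selection frequency `> 1/2` is acyclic, then it minimizes the
GSHD aggregation score among all acyclic 0/1 matrices with zero diagonal and no
2-cycles. -/
theorem scoreGSHD_global_min {p B : ℕ} (hp : 1 ≤ p) (hB : 1 ≤ B) (α : ℝ) (hα : 0 < α)
    (E : Fin B → Fin p → Fin p → ℝ) (hE : ∀ b, IsDAGAdj (E b))
    (Astar : Fin p → Fin p → ℝ)
    (hAstar : ∀ i j, Astar i j = if 1 / 2 < gselFreq α E i j then 1 else 0)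
    (hAcyc : MatAcyclic Astar) :
    ∀ A : Fin p → Fin p → ℝ, IsDAGAdj A → MatAcyclic A →
      scoreGSHD α E Astar ≤ scoreGSHD α E A := by
  intro A hA _
  have hno : ∀ i j, Astar i j = 1 → Astar j i = 1 → False := fun i j h h' =>
    hAcyc i (Relation.TransGen.tail (Relation.TransGen.single h) h')
  have h01 : ∀ i j, Astar i j = 0 ∨ Astar i j = 1 := by
    intro i j
    rw [hAstar]
    split_ifs <;> simp
  have hS : IsDAGAdj Astar := by
    refine ⟨h01, fun i => (h01 i i).resolve_right fun h => hno i i h h, fun i j _ => ?_⟩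
    have := hno i j
    rcases h01 i j with h | h <;> rcases h01 j i with h' | h' <;>
      first
      | exact (this h h').elim
      | (rw [h, h']; norm_num)
  rw [score_eq hB α E hE _ hS, score_eq hB α E hE _ hA]
  refine Finset.sum_le_sum ?_
  rintro ⟨i, j⟩ hij
  have hij : i < j := by simpa using hij
  have h1 := hA.2.2 i j hij.ne
  have h2 := hS.2.2 i j hij.ne
  have e1 := hAstar i j
  have e2 := hAstar j i
  dsimp only
  generalize gselFreq α E i j = g at *
  generalize gselFreq α E j i = g' at *
  split_ifs at e1 e2 <;> rw [e1, e2] at h2 ⊢ <;> rcases hA.1 i j with h | h <;>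
    rcases hA.1 j i with h' | h' <;> rw [h, h'] at h1 ⊢ <;> linarith
end

section
/- (Proposition 3, addition/deletion case) Let score be a decomposable score on graphs over Fin p. Fix nodes i*, j*, k, l with l ≠ j*. Let A be a 0/1 adjacency matrix and let A* be obtained from A either by adding the edge (i*,j*) (assuming A i* j* = 0) or by deleting the edge (i*,j*) (assuming A i* j* = 1). Let O be either the addition of the edge (k,l) (assuming A k l = 0) or the deletion of the edge (k,l) (assuming A k l = 1). Then the score change of O is the same on both graphs: score(O(A)) − score(A) = score(O(A*)) − score(A*). -/
/-- Replace the entry of `A` at position `(k, l)` by `v`. -/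
def updEdge {p : ℕ} (A : Fin p → Fin p → ℝ) (k l : Fin p) (v : ℝ) :
    Fin p → Fin p → ℝ :=
  fun a b => if a = k ∧ b = l then v else A a b

/-- A decomposable score: the sum over nodes `j` of a local score `f j` of the parent
set of `j`. -/
noncomputable def decompScore {p : ℕ} (f : Fin p → Finset (Fin p) → ℝ)
    (A : Fin p → Fin p → ℝ) : ℝ :=
  ∑ j, f j (Finset.univ.filter fun i => A i j = 1)

/-- Proposition 3, addition/deletion case: if `Astar` is obtained from `A` by adding or
deleting the edge `(i*, j*)`, then any addition or deletion operation `O` on an edge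
`(k, l)` with `l ≠ j*` has the same decomposable-score change on `A` and on `Astar`. -/
theorem decompScore_change_invariant_add_delete {p : ℕ}
    (f : Fin p → Finset (Fin p) → ℝ)
    (A Astar : Fin p → Fin p → ℝ) (hA01 : ∀ i j, A i j = 0 ∨ A i j = 1)
    (istar jstar k l : Fin p) (hl : l ≠ jstar)
    (hAstar : (A istar jstar = 0 ∧ Astar = updEdge A istar jstar 1) ∨
              (A istar jstar = 1 ∧ Astar = updEdge A istar jstar 0))
    (v : ℝ) (hO : (A k l = 0 ∧ v = 1) ∨ (A k l = 1 ∧ v = 0)) :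
    decompScore f (updEdge A k l v) - decompScore f A =
      decompScore f (updEdge Astar k l v) - decompScore f Astar := by
  have h : ∃ w, Astar = updEdge A istar jstar w := by
    rcases hAstar with h | h
    · exact ⟨_, h.2⟩
    · exact ⟨_, h.2⟩
  obtain ⟨w, rfl⟩ := h
  unfold decompScore
  rw [← Finset.sum_sub_distrib, ← Finset.sum_sub_distrib]
  refine Finset.sum_congr rfl fun j _ => ?_
  by_cases hj : j = l
  · subst hj
    simp [updEdge, hl]
  · have e : ∀ (B : Fin p → Fin p → ℝ) i, updEdge B k l v i j = B i j := by
      intro B i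
      simp [updEdge, hj]
    simp only [e, sub_self]
end

section
/- (Proposition 3, reversal case) Let score be a decomposable score on graphs over Fin p. Fix nodes i*, j*, k, l with l ∉ {i*, j*}. Let A be a 0/1 adjacency matrix with A i* j* = 1 and A j* i* = 0, and let A* be obtained from A by reversing the edge (i*,j*). Let O be either the addition of the edge (k,l) (assuming A k l = 0) or the deletion of the edge (k,l) (assuming A k l = 1). Then score(O(A)) − score(A) = score(O(A*)) − score(A*). -/
/-- Proposition 3, reversal case: if `Astar` is obtained from `A` by reversing the edge
`(i*, j*)`, then any addition or deletion operation on an edge `(k, l)` with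
`l ∉ {i*, j*}` has the same decomposable-score change on `A` and on `Astar`. -/
theorem decompScore_change_invariant_reverse {p : ℕ}
    (f : Fin p → Finset (Fin p) → ℝ)
    (A Astar : Fin p → Fin p → ℝ) (hA01 : ∀ i j, A i j = 0 ∨ A i j = 1)
    (istar jstar k l : Fin p) (hl₁ : l ≠ istar) (hl₂ : l ≠ jstar)
    (hedge : A istar jstar = 1) (hrev : A jstar istar = 0)
    (hAstar : Astar = updEdge (updEdge A istar jstar 0) jstar istar 1)
    (v : ℝ) (hO : (A k l = 0 ∧ v = 1) ∨ (A k l = 1 ∧ v = 0)) :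
    decompScore f (updEdge A k l v) - decompScore f A =
      decompScore f (updEdge Astar k l v) - decompScore f Astar := by
  unfold decompScore
  rw [← Finset.sum_sub_distrib, ← Finset.sum_sub_distrib]
  refine Finset.sum_congr rfl fun j _ => ?_
  by_cases hj : j = l
  · have h : ∀ a, Astar a j = A a j := by
      intro a
      simp [hAstar, updEdge, hj, hl₁, hl₂]
    simp only [updEdge, h]
    congr!
  · simp [updEdge, hj]
end

section
/- (Proposition 4, acyclic check after an addition) Let r : V → V → Prop be an acyclic relation, let r* be r with the edge (i*,j*) added, and assume r* is acyclic. Let (i,j) be a pair of nodes such that r with the edge (i,j) added is acyclic. Then r* with the edge (i,j) added fails to be acyclic if and only if i is reachable from j* in r* and i* is reachable from j in r*, i.e., Relation.ReflTransGen r* j* i and Relation.ReflTransGen r* j i*. -/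
/-- Add the edge `(i, j)` to the relation `r`. -/
def addEdge {V : Type*} (r : V → V → Prop) (i j : V) : V → V → Prop :=
  fun a b => r a b ∨ (a = i ∧ b = j)

/-- A relation is acyclic if its transitive closure is irreflexive. -/
def RelAcyclic {V : Type*} (r : V → V → Prop) : Prop :=
  Irreflexive (Relation.TransGen r)

open Relation in
theorem transGen_addEdge_cases {V : Type*} {s : V → V → Prop} {i j a b : V}
    (h : TransGen (addEdge s i j) a b) :
    TransGen s a b ∨ (ReflTransGen s a i ∧ ReflTransGen s j b) := by
  induction h with
  | single h =>
    rcases h with h | ⟨rfl, rfl⟩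
    · exact Or.inl (.single h)
    · exact Or.inr ⟨.refl, .refl⟩
  | tail _ h ih =>
    rcases h with h | ⟨rfl, rfl⟩
    · rcases ih with ih | ⟨h1, h2⟩
      · exact Or.inl (ih.tail h)
      · exact Or.inr ⟨h1, h2.tail h⟩
    · rcases ih with ih | ⟨h1, h2⟩
      · exact Or.inr ⟨ih.to_reflTransGen, .refl⟩
      · exact Or.inr ⟨h1, .refl⟩

/-- Proposition 4, acyclic check after an addition: after the acyclic addition of the
edge `(i*, j*)` to an acyclic relation `r`, the addition of an edge `(i, j)` that was
acyclic for `r` creates a cycle if and only if `i` is reachable from `j*` and `i*` is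
reachable from `j` in the updated graph. -/
theorem acyclic_check_after_addition {V : Type*} (r : V → V → Prop)
    (istar jstar i j : V)
    (hr : RelAcyclic r) (hrstar : RelAcyclic (addEdge r istar jstar))
    (hij : RelAcyclic (addEdge r i j)) :
    ¬ RelAcyclic (addEdge (addEdge r istar jstar) i j) ↔
      (Relation.ReflTransGen (addEdge r istar jstar) jstar i ∧
       Relation.ReflTransGen (addEdge r istar jstar) j istar) := by
  have hmono : ∀ {a b}, Relation.ReflTransGen r a b → ∀ p q,
      Relation.ReflTransGen (addEdge r p q) a b :=
    fun h p q => Relation.ReflTransGen.mono (fun _ _ h => Or.inl h) _ _ h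
  constructor
  · intro h
    have hx : ∃ x, Relation.TransGen (addEdge (addEdge r istar jstar) i j) x x := by
      by_contra hc
      exact h (fun x hx => hc ⟨x, hx⟩)
    obtain ⟨x, hx⟩ := hx
    rcases transGen_addEdge_cases hx with hx | ⟨h1, h2⟩
    · exact absurd hx (hrstar x)
    have hno : ¬ Relation.ReflTransGen r j i := fun h =>
      hij j (Relation.TransGen.tail' (hmono h i j) (Or.inr ⟨rfl, rfl⟩))
    rcases Relation.reflTransGen_iff_eq_or_transGen.1 (h2.trans h1) with e | ht
    · exact absurd (e ▸ Relation.ReflTransGen.refl) hno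
    · rcases transGen_addEdge_cases ht with ht | ⟨h3, h4⟩
      · exact absurd ht.to_reflTransGen hno
      · exact ⟨hmono h4 _ _, hmono h3 _ _⟩
  · rintro ⟨h1, h2⟩ hac
    have h3 : Relation.ReflTransGen (addEdge r istar jstar) j i :=
      (h2.tail (Or.inr ⟨rfl, rfl⟩)).trans h1
    exact hac j (Relation.TransGen.tail' (Relation.ReflTransGen.mono (fun _ _ h => Or.inl h) _ _ h3) (Or.inr ⟨rfl, rfl⟩))
end

section
/- (Proposition 4, acyclic check after a deletion) Let r : V → V → Prop be an acyclic relation with r i* j* (the edge (i*,j*) is present), and let r' be r with the edge (i*,j*) deleted. Suppose that adding the edge (i,j) to r creates a cycle, i.e., Relation.ReflTransGen r j i, and suppose it is NOT the case that both Relation.ReflTransGen r j* i and Relation.ReflTransGen r j i* hold. Then adding the edge (i,j) to r' still creates a cycle, i.e., Relation.ReflTransGen r' j i. -/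
/-- Delete the edge `(i, j)` from the relation `r`. -/
def delEdge {V : Type*} (r : V → V → Prop) (i j : V) : V → V → Prop :=
  fun a b => r a b ∧ ¬(a = i ∧ b = j)

/-- Proposition 4, acyclic check after a deletion: let `r` be acyclic with edge
`(i*, j*)`, and suppose adding the edge `(i, j)` to `r` creates a cycle (`i` is reachable
from `j`).  If it is not the case that both `i` is reachable from `j*` and `i*` is
reachable from `j`, then adding `(i, j)` still creates a cycle after deleting
`(i*, j*)`. -/
theorem acyclic_check_after_deletion {V : Type*} (r : V → V → Prop)
    (istar jstar i j : V)
    (hr : RelAcyclic r) (hedge : r istar jstar)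
    (hcyc : Relation.ReflTransGen r j i)
    (hnot : ¬ (Relation.ReflTransGen r jstar i ∧ Relation.ReflTransGen r j istar)) :
    Relation.ReflTransGen (delEdge r istar jstar) j i := by
  induction hcyc with
  | refl => exact Relation.ReflTransGen.refl
  | tail hab hbc ih =>
    refine Relation.ReflTransGen.tail (ih fun h => hnot ⟨h.1.tail hbc, h.2⟩) ⟨hbc, ?_⟩
    rintro ⟨rfl, rfl⟩
    exact hnot ⟨Relation.ReflTransGen.refl, hab⟩
end

section
/- (Proposition 4, acyclic check after a reversal) Let r : V → V → Prop be an acyclic relation with r i* j* and ¬ r j* i*, let r* be obtained from r by reversing the edge (i*,j*) (delete (i*,j*), then add (j*,i*)), and assume r* is acyclic. Let (i,j) be a pair of nodes such that r with the edge (i,j) added is acyclic. Then r* with the edge (i,j) added fails to be acyclic if and only if i is reachable from i* in r* and j* is reachable from j in r*, i.e., Relation.ReflTransGen r* i* i and Relation.ReflTransGen r* j j*. -/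
theorem tg_addEdge {V : Type*} {s : V → V → Prop} {i j a b : V}
    (h : Relation.TransGen (addEdge s i j) a b) :
    Relation.TransGen s a b ∨ (Relation.ReflTransGen s a i ∧ Relation.ReflTransGen s j b) := by
  induction h with
  | single h =>
    rcases h with h | ⟨rfl, rfl⟩
    · exact Or.inl (.single h)
    · exact Or.inr ⟨.refl, .refl⟩
  | tail _ h ih =>
    rcases h with h | ⟨rfl, rfl⟩
    · rcases ih with ih | ⟨h1, h2⟩
      · exact Or.inl (ih.tail h)
      · exact Or.inr ⟨h1, h2.tail h⟩
    · rcases ih with ih | ⟨h1, h2⟩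
      · exact Or.inr ⟨ih.to_reflTransGen, .refl⟩
      · exact Or.inr ⟨h1, .refl⟩

theorem rtg_mono_addEdge {V : Type*} {s : V → V → Prop} {i j a b : V}
    (h : Relation.ReflTransGen s a b) : Relation.ReflTransGen (addEdge s i j) a b :=
  Relation.ReflTransGen.mono (r := s) (fun _ _ h => Or.inl h) _ _ h

theorem cyc_addEdge {V : Type*} {s : V → V → Prop} {i j : V}
    (h : Relation.ReflTransGen s j i) : ¬ RelAcyclic (addEdge s i j) := fun hc =>
  hc i (Relation.TransGen.head' (Or.inr ⟨rfl, rfl⟩) (rtg_mono_addEdge h))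

/-- Proposition 4, acyclic check after a reversal: after the acyclic reversal of the
edge `(i*, j*)` of an acyclic relation `r`, the addition of an edge `(i, j)` that was
acyclic for `r` creates a cycle if and only if `i` is reachable from `i*` and `j*` is
reachable from `j` in the updated graph. -/
theorem acyclic_check_after_reversal {V : Type*} (r : V → V → Prop)
    (istar jstar i j : V)
    (hr : RelAcyclic r) (h₁ : r istar jstar) (h₂ : ¬ r jstar istar)
    (hrstar : RelAcyclic (addEdge (delEdge r istar jstar) jstar istar))
    (hij : RelAcyclic (addEdge r i j)) :
    ¬ RelAcyclic (addEdge (addEdge (delEdge r istar jstar) jstar istar) i j) ↔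
      (Relation.ReflTransGen (addEdge (delEdge r istar jstar) jstar istar) istar i ∧
       Relation.ReflTransGen (addEdge (delEdge r istar jstar) jstar istar) j jstar) := by
  constructor
  · intro h
    have hex : ∃ a, Relation.TransGen
        (addEdge (addEdge (delEdge r istar jstar) jstar istar) i j) a a := by
      by_contra hn
      exact h (fun a ha => hn ⟨a, ha⟩)
    obtain ⟨a, ha⟩ := hex
    rcases tg_addEdge ha with h | ⟨hai, hja⟩
    · exact absurd h (hrstar a)
    have key : ¬ Relation.ReflTransGen (delEdge r istar jstar) j i := fun hd =>
      cyc_addEdge (s := r) (Relation.ReflTransGen.mono (r := delEdge r istar jstar) (fun _ _ h => h.1) _ _ hd) hij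
    rcases Relation.reflTransGen_iff_eq_or_transGen.1 (hja.trans hai) with h | h
    · subst h
      exact absurd .refl key
    · rcases tg_addEdge h with h | ⟨h1, h2⟩
      · exact absurd h.to_reflTransGen key
      · exact ⟨rtg_mono_addEdge h2, rtg_mono_addEdge h1⟩
  · rintro ⟨h1, h2⟩
    exact cyc_addEdge ((h2.tail (Or.inr ⟨rfl, rfl⟩)).trans h1)
end
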